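/- Let μ be a Borel probability measure on ℝ satisfying the basic assumptions, with either compact support or ∫ |x|^{2+δ} dμ < ∞ for some δ > 0, let k ≥ 1, and let v_μ ∈ (0,1)ᵏ be the optimal percentile vector of μ, i.e. (v_μ)_j = F_μ(y_j) where {y_1 < … < y_k} is the support of a minimizer of ν ↦ W₁(μ,ν) over 𝒫_k(ℝ). Then there exists a constant C > 0 such that for every n > k, the Bayesian approximation ratio satisfies (∫_{ℝⁿ} SC_{v_μ} d(μ^{⊗n})) / (∫_{ℝⁿ} SC_opt d(μ^{⊗n})) ≤ 1 + C/√n. -/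

import Mathlib

open MeasureTheory Filter Topology ENNReal

/-- The 1-Wasserstein distance between two measures on ℝ, defined as the infimum of
transport costs over couplings. -/
noncomputable def W1 (α β : Measure ℝ) : ℝ :=
  sInf {c : ℝ | ∃ π : Measure (ℝ × ℝ), IsProbabilityMeasure π ∧
    π.map Prod.fst = α ∧ π.map Prod.snd = β ∧ c = ∫ p, |p.1 - p.2| ∂π}

/-- The ∞-Wasserstein distance between two measures on ℝ. -/
noncomputable def Winf (α β : Measure ℝ) : ℝ :=
  sInf {c : ℝ | ∃ π : Measure (ℝ × ℝ), IsProbabilityMeasure π ∧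
    π.map Prod.fst = α ∧ π.map Prod.snd = β ∧
    c = essSup (fun p : ℝ × ℝ => |p.1 - p.2|) π}

/-- `Pk k` : probability measures on ℝ supported on at most `k` points. -/
def Pk (k : ℕ) : Set (Measure ℝ) :=
  {ν | IsProbabilityMeasure ν ∧ ∃ s : Finset ℝ, s.card ≤ k ∧ ν ((↑s : Set ℝ)ᶜ) = 0}

/-- Wasserstein projection distance of `μ` onto `k`-point measures. -/
noncomputable def projDist (k : ℕ) (μ : Measure ℝ) : ℝ :=
  sInf {c : ℝ | ∃ ν ∈ Pk k, c = W1 μ ν}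

/-- Empirical measure of a tuple of points. -/
noncomputable def empMeas {n : ℕ} (x : Fin n → ℝ) : Measure ℝ :=
  ((n : ℝ≥0∞))⁻¹ • ∑ i : Fin n, Measure.dirac (x i)

/-- Social cost of facility placement `y` for agents at `x`. -/
noncomputable def SC {n k : ℕ} (x : Fin n → ℝ) (y : Fin k → ℝ) : ℝ :=
  (n : ℝ)⁻¹ * ∑ i : Fin n, ⨅ j : Fin k, |x i - y j|

/-- Optimal social cost for `k` facilities. -/
noncomputable def SCopt (k : ℕ) {n : ℕ} (x : Fin n → ℝ) : ℝ :=
  ⨅ y : Fin k → ℝ, SC x y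

/-- Topological support of a measure on ℝ. -/
def msupport (ν : Measure ℝ) : Set ℝ := {t : ℝ | ∀ U ∈ nhds t, ν U ≠ 0}

/-- Cumulative distribution function of a measure on ℝ. -/
noncomputable def mcdf (μ : Measure ℝ) (t : ℝ) : ℝ := (μ (Set.Iic t)).toReal

/-- Quantile (generalized inverse c.d.f.) of a measure on ℝ. -/
noncomputable def mquantile (μ : Measure ℝ) (v : ℝ) : ℝ := sInf {t : ℝ | v ≤ mcdf μ t}

/-- Basic assumptions: `μ` is an absolutely continuous probability measure with density `ρ`,
supported on a (closed) interval `S`, with `ρ` positive on the interior of `S`, vanishing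
outside `S`, and differentiable on `S`. -/
def BasicAssumptions (μ : Measure ℝ) : Prop :=
  IsProbabilityMeasure μ ∧
  ∃ (ρ : ℝ → ℝ) (S : Set ℝ),
    μ = volume.withDensity (fun x => ENNReal.ofReal (ρ x)) ∧
    IsClosed S ∧ S.OrdConnected ∧ μ Sᶜ = 0 ∧
    (∀ x ∈ interior S, 0 < ρ x) ∧ (∀ x ∉ S, ρ x = 0) ∧
    DifferentiableOn ℝ ρ S

/-- The percentile mechanism: facility `j` is placed at the `(⌊(n-1)vⱼ⌋+1)`-th smallest
coordinate of `x`. -/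
noncomputable def percentileMech {k : ℕ} (v : Fin k → ℝ) {n : ℕ} (x : Fin n → ℝ) :
    Fin k → ℝ :=
  fun j =>
    if h : 0 < n then
      x (Tuple.sort x ⟨min ⌊((n : ℝ) - 1) * v j⌋₊ (n - 1),
        Nat.lt_of_le_of_lt (min_le_right _ _) (by omega)⟩)
    else 0

/-- Social cost of the percentile mechanism with percentile vector `v`. -/
noncomputable def SCv {k : ℕ} (v : Fin k → ℝ) {n : ℕ} (x : Fin n → ℝ) : ℝ :=
  SC x (percentileMech v x)

/-- Cumulative masses of the Voronoi cells of the points `y 0 < y 1 < ⋯ < y (k-1)`: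
`cellBd μ y j = F_μ(z_j)` where `z_j = (y (j-1) + y j)/2` for `1 ≤ j ≤ k-1` (1-based),
with the conventions `F_μ(z_0) = 0` and `F_μ(z_k) = 1`. -/
noncomputable def cellBd (μ : Measure ℝ) {k : ℕ} (y : Fin k → ℝ) (j : ℕ) : ℝ :=
  if h0 : j = 0 then 0
  else if hk : k ≤ j then 1
  else mcdf μ ((y ⟨j - 1, by omega⟩ + y ⟨j, by omega⟩) / 2)

/-- The measure `ν_{Q_v}`: atoms at the quantiles `F_μ^{[-1]}(vⱼ)` weighted by the masses of
their Voronoi cells. -/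
noncomputable def nuQ (μ : Measure ℝ) {k : ℕ} (v : Fin k → ℝ) : Measure ℝ :=
  ∑ i : Fin k,
    ENNReal.ofReal (cellBd μ (fun j => mquantile μ (v j)) ((i : ℕ) + 1) -
        cellBd μ (fun j => mquantile μ (v j)) (i : ℕ)) •
      Measure.dirac (mquantile μ (v i))

/-- Distance from `t` to the nearest of the points `z j`. -/
noncomputable def minDist {k : ℕ} (z : Fin k → ℝ) (t : ℝ) : ℝ := ⨅ j : Fin k, |t - z j|

section MinDist

variable {k : ℕ}

theorem minDist_le (z : Fin k → ℝ) (t : ℝ) (j : Fin k) : minDist z t ≤ |t - z j| :=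
  ciInf_le ⟨0, by rintro _ ⟨j, rfl⟩; exact abs_nonneg _⟩ j

theorem minDist_nonneg (z : Fin k → ℝ) (t : ℝ) : 0 ≤ minDist z t :=
  Real.iInf_nonneg fun _ => abs_nonneg _

theorem exists_minDist_eq [Nonempty (Fin k)] (z : Fin k → ℝ) (t : ℝ) :
    ∃ j, minDist z t = |t - z j| := by
  obtain ⟨j, hj⟩ := exists_eq_ciInf_of_finite (f := fun j => |t - z j|)
  exact ⟨j, hj.symm⟩

theorem minDist_le_add [Nonempty (Fin k)] (z : Fin k → ℝ) (s t : ℝ) :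
    minDist z s ≤ minDist z t + |s - t| := by
  obtain ⟨j, hj⟩ := exists_minDist_eq z t
  rw [hj]
  refine (minDist_le z s j).trans ?_
  have := abs_sub_le s t (z j)
  linarith

theorem lipschitzWith_minDist [Nonempty (Fin k)] (z : Fin k → ℝ) :
    LipschitzWith 1 (minDist z) :=
  LipschitzWith.of_le_add fun s t => by
    simpa [Real.dist_eq] using minDist_le_add z s t

theorem minDist_le_add_sum [Nonempty (Fin k)] (z w : Fin k → ℝ) (t : ℝ) :
    minDist w t ≤ minDist z t + ∑ j, |w j - z j| := by
  obtain ⟨j, hj⟩ := exists_minDist_eq z t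
  rw [hj]
  refine (minDist_le w t j).trans ?_
  have h1 := abs_sub_le t (z j) (w j)
  have h2 : |w j - z j| ≤ ∑ j, |w j - z j| :=
    Finset.single_le_sum (f := fun j => |w j - z j|) (fun i _ => abs_nonneg _)
      (Finset.mem_univ j)
  rw [abs_sub_comm (z j)] at h1
  linarith

theorem integrable_minDist [Nonempty (Fin k)] {α : Measure ℝ} [IsFiniteMeasure α]
    (hα : Integrable (fun t : ℝ => t) α) (z : Fin k → ℝ) : Integrable (minDist z) α := by
  have j := Classical.arbitrary (Fin k)
  refine Integrable.mono' (g := fun t => |t - z j|) (hα.sub (integrable_const _)).abs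
    (lipschitzWith_minDist z).continuous.aestronglyMeasurable (ae_of_all _ fun t => ?_)
  rw [Real.norm_of_nonneg (minDist_nonneg z t)]
  exact minDist_le z t j

theorem SC_eq {n : ℕ} (x : Fin n → ℝ) (z : Fin k → ℝ) :
    SC x z = (n : ℝ)⁻¹ * ∑ i, minDist z (x i) := rfl

theorem SC_nonneg {n : ℕ} (x : Fin n → ℝ) (z : Fin k → ℝ) : 0 ≤ SC x z := by
  rw [SC_eq]
  exact mul_nonneg (by positivity) (Finset.sum_nonneg fun i _ => minDist_nonneg z _)

theorem SC_le_add_sum [Nonempty (Fin k)] {n : ℕ} (hn : 0 < n) (x : Fin n → ℝ)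
    (z w : Fin k → ℝ) : SC x w ≤ SC x z + ∑ j, |w j - z j| := by
  have hn' : (0 : ℝ) < n := by exact_mod_cast hn
  rw [SC_eq, SC_eq]
  have : ∑ i, minDist w (x i) ≤ ∑ i, minDist z (x i) + n * ∑ j, |w j - z j| := by
    refine (Finset.sum_le_sum fun i _ => minDist_le_add_sum z w (x i)).trans_eq ?_
    rw [Finset.sum_add_distrib]
    simp
  calc (n : ℝ)⁻¹ * ∑ i, minDist w (x i)
      ≤ (n : ℝ)⁻¹ * (∑ i, minDist z (x i) + n * ∑ j, |w j - z j|) := by gcongr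
    _ = _ := by field_simp

theorem continuous_SC [Nonempty (Fin k)] {n : ℕ} (z : Fin k → ℝ) :
    Continuous fun x : Fin n → ℝ => SC x z := by
  simp only [SC_eq]
  have := (lipschitzWith_minDist z).continuous
  fun_prop

theorem bddBelow_SC {n : ℕ} (x : Fin n → ℝ) : BddBelow (Set.range fun z : Fin k → ℝ => SC x z) :=
  ⟨0, by rintro _ ⟨z, rfl⟩; exact SC_nonneg x z⟩

theorem SCopt_le {n : ℕ} (x : Fin n → ℝ) (z : Fin k → ℝ) : SCopt k x ≤ SC x z :=
  ciInf_le (bddBelow_SC x) z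

theorem SCopt_nonneg {n : ℕ} (x : Fin n → ℝ) : 0 ≤ SCopt k x :=
  Real.iInf_nonneg fun z => SC_nonneg x z

theorem measurable_SCopt [Nonempty (Fin k)] {n : ℕ} :
    Measurable fun x : Fin n → ℝ => SCopt k x :=
  (upperSemicontinuous_ciInf (fun x => bddBelow_SC x)
    fun z => (continuous_SC z).upperSemicontinuous).measurable

end MinDist

section Emp

variable {n : ℕ}

instance isProbabilityMeasure_empMeas [NeZero n] (x : Fin n → ℝ) :
    IsProbabilityMeasure (empMeas x) := by
  constructor
  have : (n : ℝ≥0∞) ≠ 0 := by exact_mod_cast NeZero.ne n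
  simp [empMeas, ENNReal.inv_mul_cancel this]

theorem integrable_empMeas [NeZero n] (x : Fin n → ℝ) (f : ℝ → ℝ) : Integrable f (empMeas x) := by
  have : (n : ℝ≥0∞) ≠ 0 := by exact_mod_cast NeZero.ne n
  refine Integrable.smul_measure ?_ (by simpa using this)
  rw [integrable_finsetSum_measure]
  intro i _
  exact integrable_dirac (by simp)

theorem integral_empMeas (x : Fin n → ℝ) (f : ℝ → ℝ) :
    ∫ t, f t ∂(empMeas x) = (n : ℝ)⁻¹ * ∑ i, f (x i) := by
  rw [empMeas, integral_smul_measure, integral_finsetSum_measure]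
  · simp
  · intro i _
    exact integrable_dirac (by simp)

theorem SC_eq_integral {k : ℕ} (x : Fin n → ℝ) (z : Fin k → ℝ) :
    SC x z = ∫ t, minDist z t ∂(empMeas x) := by
  rw [integral_empMeas, SC_eq]

theorem mcdf_empMeas (x : Fin n → ℝ) (t : ℝ) :
    mcdf (empMeas x) t = (n : ℝ)⁻¹ * ∑ i, (Set.Iic t).indicator (fun _ => (1 : ℝ)) (x i) := by
  rw [← integral_empMeas, integral_indicator measurableSet_Iic]
  simp [mcdf, Measure.real]

theorem mcdf_empMeas_eq_card (x : Fin n → ℝ) (t : ℝ) :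
    mcdf (empMeas x) t = (n : ℝ)⁻¹ * (Finset.univ.filter fun i => x i ≤ t).card := by
  rw [mcdf_empMeas]
  simp [Set.indicator_apply]

theorem measurable_mcdf_empMeas :
    Measurable fun p : (Fin n → ℝ) × ℝ => mcdf (empMeas p.1) p.2 := by
  simp only [mcdf_empMeas]
  refine Measurable.const_mul (Finset.measurable_sum _ fun i _ => ?_) _
  have : (fun p : (Fin n → ℝ) × ℝ => (Set.Iic p.2).indicator (fun _ => (1 : ℝ)) (p.1 i)) =
      {p : (Fin n → ℝ) × ℝ | p.1 i ≤ p.2}.indicator fun _ => 1 := by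
    ext p; simp [Set.indicator_apply]
  rw [this]
  exact measurable_const.indicator (measurableSet_le (by fun_prop) (by fun_prop))

theorem monotone_mcdf (μ : Measure ℝ) [IsFiniteMeasure μ] : Monotone (mcdf μ) := fun _ _ h =>
  ENNReal.toReal_mono (measure_ne_top _ _) (measure_mono (Set.Iic_subset_Iic.2 h))

theorem mcdf_nonneg (μ : Measure ℝ) (t : ℝ) : 0 ≤ mcdf μ t := ENNReal.toReal_nonneg

theorem mcdf_le_one (μ : Measure ℝ) [IsProbabilityMeasure μ] (t : ℝ) : mcdf μ t ≤ 1 := by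
  have := ENNReal.toReal_mono ENNReal.one_ne_top (prob_le_one (μ := μ) (s := Set.Iic t))
  simpa [mcdf] using this

end Emp

/-- The function `t ↦ 𝟙(0 ≤ t) - 𝟙(x ≤ t)`, i.e. the signed indicator of the interval
between `0` and `x`. -/
noncomputable def signedStep (x t : ℝ) : ℝ :=
  (Set.Ici 0).indicator (fun _ => (1 : ℝ)) t - (Set.Ici x).indicator (fun _ => (1 : ℝ)) t

theorem signedStep_of_nonneg {x : ℝ} (hx : 0 ≤ x) :
    signedStep x = (Set.Ico 0 x).indicator fun _ => (1 : ℝ) := by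
  ext t
  simp only [signedStep, Set.indicator_apply, Set.mem_Ici, Set.mem_Ico]
  split_ifs <;> grind

theorem signedStep_of_nonpos {x : ℝ} (hx : x ≤ 0) :
    signedStep x = (Set.Ico x 0).indicator fun _ => (-1 : ℝ) := by
  ext t
  simp only [signedStep, Set.indicator_apply, Set.mem_Ici, Set.mem_Ico]
  split_ifs <;> grind

theorem measurable_signedStep : Measurable fun p : ℝ × ℝ => signedStep p.1 p.2 := by
  have h1 : Measurable fun p : ℝ × ℝ => (Set.Ici (0 : ℝ)).indicator (fun _ => (1 : ℝ)) p.2 :=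
    (measurable_const.indicator measurableSet_Ici).comp measurable_snd
  have h2 : (fun p : ℝ × ℝ => (Set.Ici p.1).indicator (fun _ => (1 : ℝ)) p.2) =
      {p : ℝ × ℝ | p.1 ≤ p.2}.indicator fun _ => 1 := by
    ext p; simp [Set.indicator_apply]
  have h3 : Measurable fun p : ℝ × ℝ => (Set.Ici p.1).indicator (fun _ => (1 : ℝ)) p.2 := by
    rw [h2]
    exact measurable_const.indicator (measurableSet_le measurable_fst measurable_snd)
  exact h1.sub h3

theorem integrable_signedStep (x : ℝ) : Integrable (signedStep x) := by
  rcases le_total 0 x with hx | hx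
  · rw [signedStep_of_nonneg hx]
    exact (integrable_indicator_iff measurableSet_Ico).2 (integrableOn_const (by simp))
  · rw [signedStep_of_nonpos hx]
    exact (integrable_indicator_iff measurableSet_Ico).2 (integrableOn_const (by simp))

theorem integral_abs_signedStep (x : ℝ) : ∫ t, |signedStep x t| = |x| := by
  rcases le_total 0 x with hx | hx
  · rw [signedStep_of_nonneg hx]
    have : (fun t => |(Set.Ico 0 x).indicator (fun _ => (1 : ℝ)) t|) =
        (Set.Ico 0 x).indicator fun _ => 1 := by
      ext t; by_cases h : t ∈ Set.Ico 0 x <;> simp [h]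
    rw [this, integral_indicator measurableSet_Ico]
    simp [hx, abs_of_nonneg hx]
  · rw [signedStep_of_nonpos hx]
    have : (fun t => |(Set.Ico x 0).indicator (fun _ => (-1 : ℝ)) t|) =
        (Set.Ico x 0).indicator fun _ => 1 := by
      ext t; by_cases h : t ∈ Set.Ico x 0 <;> simp [h]
    rw [this, integral_indicator measurableSet_Ico]
    simp [hx, abs_of_nonpos hx]

theorem LipschitzWith.integral_deriv_mul_signedStep {g : ℝ → ℝ} {K : NNReal}
    (hg : LipschitzWith K g) (x : ℝ) : ∫ t, deriv g t * signedStep x t = g x - g 0 := by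
  have key : ∫ t in (0 : ℝ)..x, deriv g t = g x - g 0 :=
    (hg.lipschitzOnWith.absolutelyContinuousOnInterval).integral_deriv_eq_sub
  rw [← key]
  rcases le_total 0 x with hx | hx
  · rw [signedStep_of_nonneg hx, intervalIntegral.integral_of_le hx,
      ← integral_Ico_eq_integral_Ioc, ← integral_indicator measurableSet_Ico]
    congr 1; ext t
    by_cases h : t ∈ Set.Ico 0 x <;> simp [h]
  · rw [signedStep_of_nonpos hx, intervalIntegral.integral_of_ge hx,
      ← integral_Ico_eq_integral_Ioc, ← integral_neg, ← integral_indicator measurableSet_Ico]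
    congr 1; ext t
    by_cases h : t ∈ Set.Ico x 0 <;> simp [h]

theorem integral_signedStep (α : Measure ℝ) [IsProbabilityMeasure α] (t : ℝ) :
    ∫ x, signedStep x t ∂α = (Set.Ici 0).indicator (fun _ => (1 : ℝ)) t - mcdf α t := by
  have h : (fun x => (Set.Ici x).indicator (fun _ => (1 : ℝ)) t) =
      (Set.Iic t).indicator fun _ => 1 := by
    ext x; simp [Set.indicator_apply]
  simp only [signedStep]
  rw [integral_sub (integrable_const _), h, integral_indicator measurableSet_Iic]
  · simp [mcdf, Measure.real]
  · rw [h]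
    exact (integrable_indicator_iff measurableSet_Iic).2 (integrableOn_const (by simp))

theorem abs_deriv_le_one {g : ℝ → ℝ} (hg : LipschitzWith 1 g) (t : ℝ) : |deriv g t| ≤ 1 := by
  simpa using norm_deriv_le_of_lipschitz hg (x₀ := t)

theorem LipschitzWith.integrable_deriv_mul_signedStep {g : ℝ → ℝ} (hg : LipschitzWith 1 g)
    {α : Measure ℝ} [IsProbabilityMeasure α] (hα : Integrable (fun t : ℝ => t) α) :
    Integrable (fun p : ℝ × ℝ => deriv g p.2 * signedStep p.1 p.2) (α.prod volume) := by
  have hmeas : Measurable fun p : ℝ × ℝ => deriv g p.2 * signedStep p.1 p.2 :=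
    ((measurable_deriv g).comp measurable_snd).mul measurable_signedStep
  have hle : ∀ x t, ‖deriv g t * signedStep x t‖ ≤ |signedStep x t| := fun x t => by
    rw [norm_mul]
    exact mul_le_of_le_one_left (abs_nonneg _) (abs_deriv_le_one hg t)
  have h_int : ∀ x, Integrable (fun t => deriv g t * signedStep x t) := fun x =>
    (integrable_signedStep x).abs.mono'
      (hmeas.comp (measurable_const.prodMk measurable_id)).aestronglyMeasurable
      (ae_of_all _ (hle x))
  refine (integrable_prod_iff hmeas.aestronglyMeasurable).2 ⟨ae_of_all _ h_int, ?_⟩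
  refine hα.abs.mono' hmeas.norm.stronglyMeasurable.integral_prod_right.aestronglyMeasurable
    (ae_of_all _ fun x => ?_)
  rw [Real.norm_of_nonneg (integral_nonneg fun _ => norm_nonneg _), ← integral_abs_signedStep]
  exact integral_mono (h_int x).norm (integrable_signedStep x).abs (hle x)

theorem LipschitzWith.integral_eq_add_integral_deriv {g : ℝ → ℝ} (hg : LipschitzWith 1 g)
    {α : Measure ℝ} [IsProbabilityMeasure α] (hα : Integrable (fun t : ℝ => t) α) :
    Integrable (fun t => deriv g t *
        ((Set.Ici 0).indicator (fun _ => (1 : ℝ)) t - mcdf α t)) ∧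
      ∫ t, g t ∂α = g 0 + ∫ t, deriv g t *
        ((Set.Ici 0).indicator (fun _ => (1 : ℝ)) t - mcdf α t) := by
  have h_int := hg.integrable_deriv_mul_signedStep hα
  have hin : ∀ t, ∫ x, deriv g t * signedStep x t ∂α = deriv g t *
      ((Set.Ici 0).indicator (fun _ => (1 : ℝ)) t - mcdf α t) := fun t => by
    rw [integral_const_mul, integral_signedStep]
  have hgi : Integrable g α := by
    refine (hα.abs.add (integrable_const |g 0|)).mono' hg.continuous.aestronglyMeasurable
      (ae_of_all _ fun t => ?_)
    have h := hg.dist_le_mul t 0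
    simp only [Real.dist_eq, NNReal.coe_one, one_mul, sub_zero] at h
    have h2 := abs_sub_abs_le_abs_sub (g t) (g 0)
    simp only [Real.norm_eq_abs, Pi.add_apply]
    linarith
  constructor
  · simpa only [hin] using h_int.integral_prod_right
  · have h := integral_integral_swap (f := fun x t => deriv g t * signedStep x t) h_int
    simp only [hin, hg.integral_deriv_mul_signedStep] at h
    rw [← h, integral_sub hgi (integrable_const _)]
    simp

theorem LipschitzWith.ofReal_integral_le {g : ℝ → ℝ} (hg : LipschitzWith 1 g)
    {α β : Measure ℝ} [IsProbabilityMeasure α] [IsProbabilityMeasure β]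
    (hα : Integrable (fun t : ℝ => t) α) (hβ : Integrable (fun t : ℝ => t) β) :
    ENNReal.ofReal (∫ t, g t ∂α) ≤ ENNReal.ofReal (∫ t, g t ∂β) +
      ∫⁻ t, ENNReal.ofReal |mcdf β t - mcdf α t| := by
  obtain ⟨hi1, h1⟩ := hg.integral_eq_add_integral_deriv hα
  obtain ⟨hi2, h2⟩ := hg.integral_eq_add_integral_deriv hβ
  have h3 : ∫ t, g t ∂α - ∫ t, g t ∂β = ∫ t, deriv g t * (mcdf β t - mcdf α t) := by
    rw [h1, h2, add_sub_add_left_eq_sub, ← integral_sub hi1 hi2]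
    congr 1; ext t; ring
  have h4 : ENNReal.ofReal (∫ t, g t ∂α - ∫ t, g t ∂β) ≤
      ∫⁻ t, ENNReal.ofReal |mcdf β t - mcdf α t| := by
    rw [h3]
    refine (ENNReal.ofReal_le_ofReal (le_abs_self _)).trans ?_
    rw [← Real.norm_eq_abs, ofReal_norm]
    refine (enorm_integral_le_lintegral_enorm _).trans (lintegral_mono fun t => ?_)
    rw [← ofReal_norm]
    refine ENNReal.ofReal_le_ofReal ?_
    rw [norm_mul]
    exact mul_le_of_le_one_left (abs_nonneg _) (abs_deriv_le_one hg t)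
  calc ENNReal.ofReal (∫ t, g t ∂α)
      = ENNReal.ofReal (∫ t, g t ∂β + (∫ t, g t ∂α - ∫ t, g t ∂β)) := by ring_nf
    _ ≤ _ := ENNReal.ofReal_add_le
    _ ≤ _ := by gcongr

theorem integral_indicator_Iic (μ : Measure ℝ) (t : ℝ) :
    ∫ s, (Set.Iic t).indicator (fun _ => (1 : ℝ)) s ∂μ = mcdf μ t := by
  rw [integral_indicator measurableSet_Iic]
  simp [mcdf, Measure.real]

section Deviation

variable {n : ℕ} (μ : Measure ℝ) [IsProbabilityMeasure μ]

theorem measurable_mcdf_empMeas_left (t : ℝ) :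
    Measurable fun x : Fin n → ℝ => mcdf (empMeas x) t :=
  (measurable_mcdf_empMeas (n := n)).comp (f := fun x => (x, t)) (by fun_prop)

theorem measurable_mcdf (μ : Measure ℝ) [IsFiniteMeasure μ] : Measurable (mcdf μ) :=
  (monotone_mcdf μ).measurable

theorem abs_mcdf_empMeas_sub_le [NeZero n] (x : Fin n → ℝ) (t : ℝ) :
    |mcdf (empMeas x) t - mcdf μ t| ≤ 1 := by
  rw [abs_le]
  constructor <;> linarith [mcdf_nonneg μ t, mcdf_le_one μ t, mcdf_nonneg (empMeas x) t,
    mcdf_le_one (empMeas x) t]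

theorem memLp_mcdf_empMeas_sub [NeZero n] (t : ℝ) (p : ℝ≥0∞) :
    MemLp (fun x : Fin n → ℝ => mcdf (empMeas x) t - mcdf μ t) p (Measure.pi fun _ => μ) :=
  MemLp.of_bound ((measurable_mcdf_empMeas_left t).sub_const _).aestronglyMeasurable 1
    (ae_of_all _ fun x => abs_mcdf_empMeas_sub_le μ x t)

theorem variance_indicator_Iic (t : ℝ) :
    ProbabilityTheory.variance ((Set.Iic t).indicator fun _ => (1 : ℝ)) μ =
      mcdf μ t * (1 - mcdf μ t) := by
  have hm : MemLp ((Set.Iic t).indicator fun _ => (1 : ℝ)) 2 μ :=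
    memLp_indicator_const 2 measurableSet_Iic 1 (Or.inr (measure_ne_top _ _))
  have hsq : ((Set.Iic t).indicator fun _ => (1 : ℝ)) ^ 2 =
      (Set.Iic t).indicator fun _ => (1 : ℝ) := by
    ext s; by_cases h : s ∈ Set.Iic t <;> simp [h]
  rw [ProbabilityTheory.variance_eq_sub hm, hsq, integral_indicator_Iic]
  ring

theorem integral_mcdf_empMeas_sub_sq [NeZero n] (t : ℝ) :
    ∫ x : Fin n → ℝ, (mcdf (empMeas x) t - mcdf μ t) ^ 2 ∂(Measure.pi fun _ => μ) =
      mcdf μ t * (1 - mcdf μ t) / n := by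
  have hn : (n : ℝ) ≠ 0 := by exact_mod_cast NeZero.ne n
  set f : ℝ → ℝ := (Set.Iic t).indicator fun _ => (1 : ℝ) with hf
  have hm : MemLp f 2 μ :=
    memLp_indicator_const 2 measurableSet_Iic 1 (Or.inr (measure_ne_top _ _))
  have hmeas : Measurable f := measurable_const.indicator measurableSet_Iic
  have hi : ∀ i : Fin n, ∫ x : Fin n → ℝ, f (x i) ∂(Measure.pi fun _ => μ) = mcdf μ t := fun i =>
    (integral_comp_eval hmeas.aestronglyMeasurable).trans (integral_indicator_Iic μ t)
  have hvar := ProbabilityTheory.variance_sum_pi (μ := fun _ : Fin n => μ) (X := fun _ => f)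
    fun _ => hm
  have hmean : ∫ x : Fin n → ℝ, (∑ i, fun ω : Fin n → ℝ => f (ω i)) x
      ∂(Measure.pi fun _ => μ) = n * mcdf μ t := by
    simp only [Finset.sum_apply]
    rw [integral_finsetSum]
    · simp [hi]
    · exact fun i _ => integrable_comp_eval (hm.integrable one_le_two)
  rw [ProbabilityTheory.variance_eq_integral, hmean] at hvar
  · simp only [variance_indicator_Iic, hf, Finset.sum_const, Finset.card_univ, Fintype.card_fin,
      nsmul_eq_mul, Finset.sum_apply] at hvar
    have h : ∀ x : Fin n → ℝ, (mcdf (empMeas x) t - mcdf μ t) ^ 2 = ((n : ℝ) ^ 2)⁻¹ *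
        (∑ i, (Set.Iic t).indicator (fun _ => (1 : ℝ)) (x i) - n * mcdf μ t) ^ 2 := fun x => by
      rw [mcdf_empMeas]
      field_simp
    simp only [h]
    rw [integral_const_mul, hvar]
    field_simp
  · exact (Finset.aemeasurable_sum _ fun i _ => (hmeas.comp (measurable_pi_apply i)).aemeasurable)

theorem lintegral_mcdf_empMeas_sub_sq [NeZero n] (t : ℝ) :
    ∫⁻ x : Fin n → ℝ, ENNReal.ofReal ((mcdf (empMeas x) t - mcdf μ t) ^ 2)
        ∂(Measure.pi fun _ => μ) = ENNReal.ofReal (mcdf μ t * (1 - mcdf μ t) / n) := by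
  rw [← integral_mcdf_empMeas_sub_sq, ofReal_integral_eq_lintegral_ofReal
    (memLp_mcdf_empMeas_sub μ t 2).integrable_sq (ae_of_all _ fun _ => sq_nonneg _)]

theorem lintegral_abs_mcdf_empMeas_sub_le [NeZero n] (t : ℝ) :
    ∫⁻ x : Fin n → ℝ, ENNReal.ofReal |mcdf (empMeas x) t - mcdf μ t| ∂(Measure.pi fun _ => μ) ≤
      ENNReal.ofReal (√(mcdf μ t * (1 - mcdf μ t)) / √n) := by
  have hm := (memLp_mcdf_empMeas_sub (n := n) μ t 2).norm
  simp only [Real.norm_eq_abs] at hm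
  rw [← ofReal_integral_eq_lintegral_ofReal (hm.integrable one_le_two)
    (ae_of_all _ fun _ => abs_nonneg _)]
  refine ENNReal.ofReal_le_ofReal ?_
  rw [← Real.sqrt_div' _ (Nat.cast_nonneg n)]
  refine Real.le_sqrt_of_sq_le ?_
  rw [← integral_mcdf_empMeas_sub_sq]
  have h := ProbabilityTheory.variance_nonneg (fun x : Fin n → ℝ =>
    |mcdf (empMeas x) t - mcdf μ t|) (Measure.pi fun _ => μ)
  rw [ProbabilityTheory.variance_eq_sub hm] at h
  simpa using h

end Deviation

theorem exists_moment {μ : Measure ℝ} [IsProbabilityMeasure μ]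
    (hmom : (∃ a b : ℝ, μ ((Set.Icc a b)ᶜ) = 0) ∨
      ∃ δ : ℝ, 0 < δ ∧ Integrable (fun x : ℝ => |x| ^ ((2 : ℝ) + δ)) μ) :
    ∃ r : ℝ, 2 < r ∧ Integrable (fun x : ℝ => |x| ^ r) μ := by
  rcases hmom with ⟨a, b, hab⟩ | ⟨δ, hδ, hi⟩
  · refine ⟨3, by norm_num, Integrable.of_bound (C := max |a| |b| ^ (3 : ℝ))
      (measurable_norm.pow_const _).aestronglyMeasurable ?_⟩
    have : ∀ᵐ x ∂μ, x ∈ Set.Icc a b := hab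
    filter_upwards [this] with x hx
    rw [Real.norm_of_nonneg (by positivity)]
    exact Real.rpow_le_rpow (abs_nonneg x) (abs_le_max_abs_abs hx.1 hx.2) (by norm_num)
  · exact ⟨2 + δ, by linarith, hi⟩

theorem integrable_id_of_moment {μ : Measure ℝ} [IsProbabilityMeasure μ] {r : ℝ} (hr : 2 < r)
    (hi : Integrable (fun x : ℝ => |x| ^ r) μ) : Integrable (fun x : ℝ => x) μ := by
  refine ((integrable_const (1 : ℝ)).add hi).mono' (by fun_prop) (ae_of_all _ fun x => ?_)
  simp only [Real.norm_eq_abs, Pi.add_apply]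
  rcases le_total |x| 1 with h | h
  · linarith [Real.rpow_nonneg (abs_nonneg x) r]
  · have := Real.self_le_rpow_of_one_le h (by linarith : 1 ≤ r)
    linarith

theorem integrable_one_add_abs_rpow {μ : Measure ℝ} [IsProbabilityMeasure μ] {r : ℝ} (hr : 2 < r)
    (hi : Integrable (fun x : ℝ => |x| ^ r) μ) : Integrable (fun x : ℝ => (1 + |x|) ^ r) μ := by
  refine (((integrable_const (1 : ℝ)).add hi).const_mul (2 ^ r)).mono'
    ((measurable_norm.const_add 1).pow_const r).aestronglyMeasurable
    (ae_of_all _ fun x => ?_)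
  rw [Real.norm_of_nonneg (by positivity)]
  simp only [Pi.add_apply]
  have h2 : (0 : ℝ) ≤ 2 ^ r := by positivity
  have hx := Real.rpow_nonneg (abs_nonneg x) r
  rcases le_total |x| 1 with h | h
  · have : (1 + |x|) ^ r ≤ 2 ^ r := Real.rpow_le_rpow (by positivity) (by linarith) (by linarith)
    nlinarith
  · have : (1 + |x|) ^ r ≤ (2 * |x|) ^ r :=
      Real.rpow_le_rpow (by positivity) (by linarith) (by linarith)
    rw [Real.mul_rpow (by norm_num) (abs_nonneg x)] at this
    nlinarith

theorem mcdf_mul_one_sub_le {μ : Measure ℝ} [IsProbabilityMeasure μ] {r : ℝ} (hr : 2 < r)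
    (hi : Integrable (fun x : ℝ => |x| ^ r) μ) (t : ℝ) :
    mcdf μ t * (1 - mcdf μ t) ≤ (∫ x, (1 + |x|) ^ r ∂μ) * (1 + |t|) ^ (-r) := by
  have hpos : 0 < (1 + |t|) ^ r := by positivity
  have hmarkov := mul_meas_ge_le_integral_of_nonneg (μ := μ) (f := fun x => (1 + |x|) ^ r)
    (ae_of_all _ fun x => by positivity) (integrable_one_add_abs_rpow hr hi) ((1 + |t|) ^ r)
  have hbound : μ.real {x | (1 + |t|) ^ r ≤ (1 + |x|) ^ r} ≤
      (∫ x, (1 + |x|) ^ r ∂μ) * (1 + |t|) ^ (-r) := by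
    rw [Real.rpow_neg (by positivity), ← div_eq_mul_inv, le_div_iff₀ hpos]
    linarith
  have hmem : ∀ x, |t| ≤ |x| → x ∈ {x | (1 + |t|) ^ r ≤ (1 + |x|) ^ r} := fun x hx =>
    Real.rpow_le_rpow (by positivity) (by linarith) (by linarith)
  have h0 := mcdf_nonneg μ t
  have h1 := mcdf_le_one μ t
  refine le_trans ?_ hbound
  rcases le_total 0 t with ht | ht
  · have h2 : 1 - mcdf μ t = μ.real (Set.Ioi t) := by
      rw [← Set.compl_Iic, probReal_compl_eq_one_sub measurableSet_Iic]
      rfl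
    have h3 : μ.real (Set.Ioi t) ≤ μ.real {x | (1 + |t|) ^ r ≤ (1 + |x|) ^ r} :=
      measureReal_mono fun x hx => hmem x (abs_le_abs_of_nonneg ht (le_of_lt hx))
    nlinarith
  · have h3 : mcdf μ t ≤ μ.real {x | (1 + |t|) ^ r ≤ (1 + |x|) ^ r} :=
      measureReal_mono (s₁ := Set.Iic t) fun x hx => hmem x (abs_le_abs_of_nonpos ht hx)
    nlinarith

theorem lintegral_sqrt_mcdf_lt_top {μ : Measure ℝ} [IsProbabilityMeasure μ] {r : ℝ} (hr : 2 < r)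
    (hi : Integrable (fun x : ℝ => |x| ^ r) μ) :
    ∫⁻ t, ENNReal.ofReal √(mcdf μ t * (1 - mcdf μ t)) < ⊤ := by
  set M := ∫ x, (1 + |x|) ^ r ∂μ
  have h_int : Integrable fun t : ℝ => √M * (1 + ‖t‖) ^ (-(r / 2)) :=
    (integrable_one_add_norm (by simp; linarith)).const_mul _
  refine lt_of_le_of_lt (lintegral_mono fun t => ENNReal.ofReal_le_ofReal ?_) h_int.lintegral_lt_top
  refine Real.sqrt_le_iff.2 ⟨by positivity, (mcdf_mul_one_sub_le hr hi t).trans_eq ?_⟩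
  have hM : 0 ≤ M := integral_nonneg fun x => by positivity
  rw [mul_pow, Real.sq_sqrt hM, ← Real.rpow_natCast, ← Real.rpow_mul (by positivity)]
  congr 2
  push_cast
  ring

theorem W1_nonneg (α β : Measure ℝ) : 0 ≤ W1 α β := by
  refine Real.sInf_nonneg ?_
  rintro _ ⟨π, -, -, -, rfl⟩
  exact integral_nonneg fun _ => abs_nonneg _

theorem exists_measurable_nearest {k : ℕ} [NeZero k] (z : Fin k → ℝ) :
    ∃ T : ℝ → ℝ, Measurable T ∧ (∀ t, T t ∈ Set.range z) ∧ ∀ t, |t - T t| = minDist z t := by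
  have hk : 0 < k := Nat.pos_of_ne_zero (NeZero.ne k)
  let e : ℕ → ℝ := fun i => z ⟨min i (k - 1), by omega⟩
  refine ⟨SimpleFunc.nearestPt e (k - 1), SimpleFunc.measurable _, ?_, ?_⟩
  · intro t
    exact ⟨_, rfl⟩
  · intro t
    refine le_antisymm (le_ciInf fun j => ?_) (minDist_le z t _)
    have h := SimpleFunc.edist_nearestPt_le e t (k := j) (N := k - 1) (by omega)
    have hej : e j = z j := by
      simp only [e]
      congr
      simp only [min_eq_left_iff]
      omega
    rw [hej, edist_dist, edist_dist, ENNReal.ofReal_le_ofReal_iff dist_nonneg,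
      dist_comm, dist_comm _ t] at h
    exact h

theorem projDist_le {k : ℕ} [NeZero k] (μ : Measure ℝ) [IsProbabilityMeasure μ]
    (z : Fin k → ℝ) : projDist k μ ≤ ∫ t, minDist z t ∂μ := by
  classical
  obtain ⟨T, hT, hTz, hTd⟩ := exists_measurable_nearest z
  have hprob : IsProbabilityMeasure (μ.map T) := Measure.isProbabilityMeasure_map hT.aemeasurable
  have hbdd : BddBelow {c : ℝ | ∃ ν ∈ Pk k, c = W1 μ ν} :=
    ⟨0, by rintro _ ⟨ν, -, rfl⟩; exact W1_nonneg μ ν⟩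
  have hmem : μ.map T ∈ Pk k := by
    refine ⟨hprob, Finset.univ.image z, Finset.card_image_le.trans (by simp), ?_⟩
    rw [Measure.map_apply hT (Finset.measurableSet _).compl]
    convert measure_empty (μ := μ)
    ext t
    simpa using hTz t
  refine (csInf_le hbdd ⟨_, hmem, rfl⟩).trans ?_
  have hTT : Measurable fun t => (t, T t) := measurable_id.prodMk hT
  refine csInf_le ⟨0, ?_⟩ ⟨μ.map fun t => (t, T t),
    Measure.isProbabilityMeasure_map hTT.aemeasurable, ?_, ?_, ?_⟩
  · rintro _ ⟨π, -, -, -, rfl⟩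
    exact integral_nonneg fun _ => abs_nonneg _
  · rw [Measure.map_map measurable_fst hTT]
    exact Measure.map_id
  · rw [Measure.map_map measurable_snd hTT]
    rfl
  · rw [integral_map hTT.aemeasurable (by fun_prop)]
    simp only [hTd]

theorem integral_minDist_le_W1 {k : ℕ} [NeZero k] {μ ν : Measure ℝ} [IsProbabilityMeasure μ]
    [IsProbabilityMeasure ν] (hμ : Integrable (fun t : ℝ => t) μ) {y : Fin k → ℝ}
    (hν : ν (Set.range y)ᶜ = 0) : ∫ t, minDist y t ∂μ ≤ W1 μ ν := by
  refine le_csInf ⟨_, μ.prod ν, inferInstance, by simp, by simp, rfl⟩ ?_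
  rintro _ ⟨π, hπ, h1, h2, rfl⟩
  have hy : ∀ᵐ p ∂π, p.2 ∈ Set.range y := by
    have h : ∀ᵐ t ∂(π.map Prod.snd), t ∈ Set.range y := by rw [h2]; exact hν
    exact ae_of_ae_map measurable_snd.aemeasurable h
  have hi1 : Integrable (fun p : ℝ × ℝ => p.1) π := by
    rw [← h1] at hμ
    exact hμ.comp_measurable measurable_fst
  have hi2 : Integrable (fun p : ℝ × ℝ => p.2) π := by
    refine Integrable.of_bound (C := ∑ j, |y j|) (by fun_prop) ?_
    filter_upwards [hy] with p hp
    obtain ⟨j, hj⟩ := hp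
    rw [← hj, Real.norm_eq_abs]
    exact Finset.single_le_sum (f := fun j => |y j|) (fun _ _ => abs_nonneg _)
      (Finset.mem_univ j)
  have hm := (lipschitzWith_minDist y).continuous
  have h3 : ∫ t, minDist y t ∂μ = ∫ p, minDist y p.1 ∂π := by
    rw [← h1, integral_map measurable_fst.aemeasurable hm.aestronglyMeasurable]
  rw [h3]
  refine integral_mono_ae ?_ (hi1.sub hi2).abs ?_
  · have h4 := integrable_minDist hμ y
    rw [← h1] at h4
    exact h4.comp_measurable measurable_fst
  · filter_upwards [hy] with p hp
    obtain ⟨j, hj⟩ := hp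
    rw [← hj]
    exact minDist_le y p.1 j

theorem measure_compl_range_eq_zero {k : ℕ} {ν : Measure ℝ} (hν : ν ∈ Pk k) {y : Fin k → ℝ}
    (hsupp : msupport ν = Set.range y) : ν (Set.range y)ᶜ = 0 := by
  obtain ⟨-, s, -, hs⟩ := hν
  have hsub : (Set.range y)ᶜ ⊆ (↑s : Set ℝ)ᶜ ∪ (↑s ∩ (Set.range y)ᶜ) := by
    intro t ht
    by_cases h : t ∈ (↑s : Set ℝ)
    · exact Or.inr ⟨h, ht⟩
    · exact Or.inl h
  refine measure_mono_null hsub (measure_union_null hs ?_)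
  have hfin : ((↑s : Set ℝ) ∩ (Set.range y)ᶜ).Countable :=
    s.countable_toSet.mono Set.inter_subset_left
  rw [← Set.biUnion_of_singleton ((↑s : Set ℝ) ∩ (Set.range y)ᶜ)]
  refine (measure_biUnion_null_iff hfin).2 fun t ht => ?_
  have h : t ∉ msupport ν := hsupp ▸ ht.2
  simp only [msupport, Set.mem_ofPred_eq, not_forall, not_not] at h
  obtain ⟨U, hU, hU0⟩ := h
  exact measure_mono_null (Set.singleton_subset_iff.2 (mem_of_mem_nhds hU)) hU0

/-- The open Voronoi cell of `y j`. -/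
def openCell {k : ℕ} (y : Fin k → ℝ) (j : Fin k) : Set ℝ := {t | ∀ i, i ≠ j → |t - y j| < |t - y i|}

theorem measurableSet_openCell {k : ℕ} (y : Fin k → ℝ) (j : Fin k) :
    MeasurableSet (openCell y j) := by
  have : openCell y j = ⋂ i, ⋂ _ : i ≠ j, {t | |t - y j| < |t - y i|} := by
    ext t; simp [openCell]
  rw [this]
  exact MeasurableSet.iInter fun i => MeasurableSet.iInter fun _ =>
    measurableSet_lt (by fun_prop) (by fun_prop)

theorem minDist_update_le_abs {k : ℕ} (y : Fin k → ℝ) (j : Fin k) (t q : ℝ) :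
    minDist (Function.update y j q) t ≤ |t - q| := by
  simpa using minDist_le (Function.update y j q) t j

section Optimal

variable {k : ℕ} [NeZero k] {μ : Measure ℝ} [IsProbabilityMeasure μ] {y : Fin k → ℝ}

theorem minDist_eq_of_mem_openCell {j : Fin k} {t : ℝ} (ht : t ∈ openCell y j) :
    minDist y t = |t - y j| := by
  obtain ⟨i, hi⟩ := exists_minDist_eq y t
  by_cases h : i = j
  · rw [hi, h]
  · have := ht i h
    exact absurd (minDist_le y t j) (by linarith)

theorem minDist_update_le {j : Fin k} {t : ℝ} (ht : t ∉ openCell y j) (q : ℝ) :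
    minDist (Function.update y j q) t ≤ minDist y t := by
  obtain ⟨i, hi⟩ := exists_minDist_eq y t
  have hne : ∀ i, i ≠ j → minDist (Function.update y j q) t ≤ |t - y i| := fun i h => by
    simpa [h] using minDist_le (Function.update y j q) t i
  by_cases h : i = j
  · simp only [openCell, Set.mem_ofPred_eq, not_forall, not_lt] at ht
    obtain ⟨l, hl, hle⟩ := ht
    rw [hi, h]
    exact (hne l hl).trans hle
  · rw [hi]
    exact hne i h

/-- Moving `y j` to `q` cannot pay off, so the part of the cell of `y j` that gets closer is no
heavier than the rest of the cell. -/
theorem measureReal_openCell_inter_le (hμ : Integrable (fun t : ℝ => t) μ)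
    (hopt : ∀ z : Fin k → ℝ, ∫ t, minDist y t ∂μ ≤ ∫ t, minDist z t ∂μ) {j : Fin k} {q : ℝ}
    (hq : q ≠ y j) {H : Set ℝ} (hH : MeasurableSet H)
    (hclose : ∀ t ∈ H, |t - q| ≤ |t - y j| - |y j - q|) :
    μ.real (openCell y j ∩ H) ≤ μ.real (openCell y j ∩ Hᶜ) := by
  have hA := measurableSet_openCell y j
  have hpos : 0 < |y j - q| := abs_pos.2 (sub_ne_zero.2 hq.symm)
  set f : ℝ → ℝ := (openCell y j ∩ Hᶜ).indicator fun _ => |y j - q|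
  set g : ℝ → ℝ := (openCell y j ∩ H).indicator fun _ => |y j - q|
  have hif : Integrable f μ :=
    (integrable_indicator_iff (hA.inter hH.compl)).2 (integrableOn_const (by simp))
  have hig : Integrable g μ :=
    (integrable_indicator_iff (hA.inter hH)).2 (integrableOn_const (by simp))
  have hpt : ∀ t, minDist (Function.update y j q) t ≤ minDist y t + (f t - g t) := fun t => by
    by_cases hc : t ∈ openCell y j
    · have h1 := minDist_update_le_abs y j t q
      rw [minDist_eq_of_mem_openCell hc]
      by_cases ht : t ∈ H
      · have := hclose t ht
        simp only [f, g, Set.indicator, Set.mem_inter_iff, Set.mem_compl_iff, hc, ht]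
        simp
        linarith
      · have := abs_sub_le t (y j) q
        simp only [f, g, Set.indicator, Set.mem_inter_iff, Set.mem_compl_iff, hc, ht]
        simp
        linarith
    · have := minDist_update_le hc q
      simpa [f, g, hc] using this
  have hi := integrable_minDist hμ y
  have h_int := (hopt _).trans (integral_mono (integrable_minDist hμ (Function.update y j q))
    (hi.add (hif.sub hig)) hpt)
  rw [integral_add' hi (hif.sub hig), integral_sub' hif hig,
    integral_indicator (hA.inter hH.compl), integral_indicator (hA.inter hH)] at h_int
  simp only [integral_const, smul_eq_mul, measureReal_restrict_apply_univ] at h_int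
  by_contra! hlt
  nlinarith

theorem measure_openCell_eq_zero_of_antitone (hμ : Integrable (fun t : ℝ => t) μ)
    (hopt : ∀ z : Fin k → ℝ, ∫ t, minDist y t ∂μ ≤ ∫ t, minDist z t ∂μ) {j : Fin k} {q : ℕ → ℝ}
    (hq : ∀ m, q m ≠ y j) {H : ℕ → Set ℝ} (hH : ∀ m, MeasurableSet (H m)) (hmono : Monotone H)
    (hclose : ∀ m, ∀ t ∈ H m, |t - q m| ≤ |t - y j| - |y j - q m|)
    (hlim : μ (⋂ m, (H m)ᶜ) = 0) : μ (openCell y j) = 0 := by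
  have hA := measurableSet_openCell y j
  have htend : Tendsto (fun m => μ ((H m)ᶜ)) atTop (𝓝 0) := by
    rw [← hlim]
    exact tendsto_measure_iInter_atTop (fun m => (hH m).compl.nullMeasurableSet)
      (fun _ _ h => Set.compl_subset_compl.2 (hmono h)) ⟨0, measure_ne_top _ _⟩
  have hle : ∀ m, μ (openCell y j) ≤ 2 * μ ((H m)ᶜ) := fun m => by
    have h1 := measureReal_openCell_inter_le hμ hopt (hq m) (hH m) (hclose m)
    have h1' : μ (openCell y j ∩ H m) ≤ μ (openCell y j ∩ (H m)ᶜ) :=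
      (ENNReal.toReal_le_toReal (measure_ne_top _ _) (measure_ne_top _ _)).1 h1
    have h2 : μ (openCell y j ∩ (H m)ᶜ) ≤ μ ((H m)ᶜ) := measure_mono Set.inter_subset_right
    rw [← measure_inter_add_sdiff (openCell y j) (hH m), two_mul]
    exact add_le_add (h1'.trans h2) h2
  have h2 : Tendsto (fun m => 2 * μ ((H m)ᶜ)) atTop (𝓝 (2 * 0)) :=
    ENNReal.Tendsto.const_mul htend (Or.inr (by simp))
  rw [mul_zero] at h2
  exact le_antisymm (ge_of_tendsto' h2 hle) zero_le

variable [NullSingletonClass μ]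

theorem integral_minDist_pos (hμ : Integrable (fun t : ℝ => t) μ) (z : Fin k → ℝ) :
    0 < ∫ t, minDist z t ∂μ := by
  refine (integral_nonneg fun t => minDist_nonneg z t).lt_of_ne' fun h => ?_
  rw [integral_eq_zero_iff_of_nonneg (fun t => minDist_nonneg z t) (integrable_minDist hμ z)] at h
  have h1 : ∀ᵐ t ∂μ, t ∉ Set.range z := by
    have := (Set.finite_range z).measure_zero μ
    exact measure_eq_zero_iff_ae_notMem.1 this
  have h2 : ∀ᵐ _t ∂μ, False := by
    filter_upwards [h, h1] with t ht ht1
    obtain ⟨j, hj⟩ := exists_minDist_eq z t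
    rw [ht, Pi.zero_apply, eq_comm, abs_eq_zero, sub_eq_zero] at hj
    exact ht1 ⟨j, hj.symm⟩
  exact IsProbabilityMeasure.ne_zero μ (by simpa using h2)

theorem measure_openCell_ne_zero (hμ : Integrable (fun t : ℝ => t) μ)
    (hopt : ∀ z : Fin k → ℝ, ∫ t, minDist y t ∂μ ≤ ∫ t, minDist z t ∂μ) (j : Fin k) :
    μ (openCell y j) ≠ 0 := by
  intro h0
  have hle : ∀ q : ℚ, ∀ᵐ t ∂μ, minDist y t ≤ |t - q| := fun q => by
    have hae : minDist (Function.update y j q) ≤ᵐ[μ] minDist y := by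
      filter_upwards [measure_eq_zero_iff_ae_notMem.1 h0] with t ht
      exact minDist_update_le ht q
    have hi1 := integrable_minDist hμ (Function.update y j (q : ℝ))
    have hi2 := integrable_minDist hμ y
    have heq := (integral_eq_iff_of_ae_le hi1 hi2 hae).1
      (le_antisymm (integral_mono_ae hi1 hi2 hae) (hopt _))
    filter_upwards [heq] with t ht
    rw [← ht]
    exact minDist_update_le_abs y j t q
  have hzero : ∀ᵐ t ∂μ, minDist y t = 0 := by
    filter_upwards [ae_all_iff.2 hle] with t ht
    refine le_antisymm (le_of_forall_pos_le_add fun ε hε => ?_) (minDist_nonneg y t)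
    obtain ⟨q, hq1, hq2⟩ := exists_rat_btwn (show t < t + ε by linarith)
    refine (ht q).trans ?_
    rw [abs_le]
    constructor <;> linarith
  have := integral_minDist_pos hμ y
  rw [integral_congr_ae hzero] at this
  simp at this

theorem measure_Ioi_ne_zero (hμ : Integrable (fun t : ℝ => t) μ)
    (hopt : ∀ z : Fin k → ℝ, ∫ t, minDist y t ∂μ ≤ ∫ t, minDist z t ∂μ) (j : Fin k) :
    μ (Set.Ioi (y j)) ≠ 0 := by
  intro h0
  obtain ⟨u, hu, hlt, hlim⟩ := exists_seq_strictMono_tendsto (y j)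
  refine measure_openCell_ne_zero hμ hopt j (measure_openCell_eq_zero_of_antitone hμ hopt
    (fun m => (hlt m).ne) (H := fun m => Set.Iic (u m)) (fun m => measurableSet_Iic)
    (fun _ _ h => Set.Iic_subset_Iic.2 (hu.monotone h)) ?_ ?_)
  · intro m t ht
    have h1 := hlt m
    have h2 : t ≤ u m := ht
    rw [abs_of_nonpos (by linarith), abs_of_nonpos (by linarith), abs_of_pos (by linarith)]
    linarith
  · have hsub : ⋂ m, (Set.Iic (u m))ᶜ ⊆ Set.Ici (y j) := fun t ht => by
      simp only [Set.compl_Iic, Set.mem_iInter, Set.mem_Ioi] at ht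
      exact le_of_tendsto' hlim fun m => (ht m).le
    refine measure_mono_null hsub ?_
    rwa [measure_congr Ioi_ae_eq_Ici.symm]

theorem measure_Iio_ne_zero (hμ : Integrable (fun t : ℝ => t) μ)
    (hopt : ∀ z : Fin k → ℝ, ∫ t, minDist y t ∂μ ≤ ∫ t, minDist z t ∂μ) (j : Fin k) :
    μ (Set.Iio (y j)) ≠ 0 := by
  intro h0
  obtain ⟨u, hu, hlt, hlim⟩ := exists_seq_strictAnti_tendsto (y j)
  refine measure_openCell_ne_zero hμ hopt j (measure_openCell_eq_zero_of_antitone hμ hopt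
    (fun m => (hlt m).ne') (H := fun m => Set.Ici (u m)) (fun m => measurableSet_Ici)
    (fun _ _ h => Set.Ici_subset_Ici.2 (hu.antitone h)) ?_ ?_)
  · intro m t ht
    have h1 := hlt m
    have h2 : u m ≤ t := ht
    rw [abs_of_nonneg (by linarith), abs_of_nonneg (by linarith), abs_of_neg (by linarith)]
    linarith
  · have hsub : ⋂ m, (Set.Ici (u m))ᶜ ⊆ Set.Iic (y j) := fun t ht => by
      simp only [Set.compl_Ici, Set.mem_iInter, Set.mem_Iio] at ht
      exact ge_of_tendsto' hlim fun m => (ht m).le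
    refine measure_mono_null hsub ?_
    rwa [measure_congr Iio_ae_eq_Iic.symm]

end Optimal

theorem mcdf_sub_mcdf (μ : Measure ℝ) [IsFiniteMeasure μ] {a b : ℝ} (hab : a ≤ b) :
    mcdf μ b - mcdf μ a = μ.real (Set.Ioc a b) := by
  rw [← Set.Iic_sdiff_Iic, measureReal_sdiff (Set.Iic_subset_Iic.2 hab) measurableSet_Iic]
  rfl

theorem BasicAssumptions.absolutelyContinuous {μ : Measure ℝ} (hμ : BasicAssumptions μ) :
    μ ≪ volume := by
  obtain ⟨-, ρ, S, rfl, -⟩ := hμ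
  exact withDensity_absolutelyContinuous _ _

theorem BasicAssumptions.exists_mcdf_growth {μ : Measure ℝ} (hμ : BasicAssumptions μ) {p : ℝ}
    (hlt : μ (Set.Iio p) ≠ 0) (hgt : μ (Set.Ioi p) ≠ 0) :
    ∃ c η : ℝ, 0 < c ∧ 0 < η ∧ ∀ t, c * min |t - p| η ≤ |mcdf μ t - mcdf μ p| := by
  obtain ⟨hprob, ρ, S, hρ, -, hS, hS0, hpos, -, hdiff⟩ := hμ
  have hmem : ∀ A : Set ℝ, μ A ≠ 0 → ∃ s ∈ S, s ∈ A := fun A hA => by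
    by_contra! h
    exact hA (measure_mono_null (fun t ht hts => h t hts ht) hS0)
  obtain ⟨a, haS, ha⟩ := hmem _ hlt
  obtain ⟨b, hbS, hb⟩ := hmem _ hgt
  have hSp : S ∈ 𝓝 p := mem_of_superset (Icc_mem_nhds ha hb) (hS.out haS hbS)
  have hcont : ContinuousAt ρ p := (hdiff.differentiableAt hSp).continuousAt
  have hρp : 0 < ρ p := hpos p (mem_interior_iff_mem_nhds.2 hSp)
  obtain ⟨η, hη, hball⟩ := Metric.eventually_nhds_iff.1
    (hcont.eventually (lt_mem_nhds (half_lt_self hρp)))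
  have hIoc : ∀ u v : ℝ, u ≤ v → p - η / 2 ≤ u → v ≤ p + η / 2 →
      ρ p / 2 * (v - u) ≤ mcdf μ v - mcdf μ u := fun u v huv hu hv => by
    rw [mcdf_sub_mcdf μ huv, Measure.real, ← ENNReal.ofReal_le_iff_le_toReal (measure_ne_top _ _)]
    conv_rhs => rw [hρ]
    rw [withDensity_apply _ measurableSet_Ioc]
    calc ENNReal.ofReal (ρ p / 2 * (v - u))
        = ∫⁻ _ in Set.Ioc u v, ENNReal.ofReal (ρ p / 2) := by
          rw [setLIntegral_const, Real.volume_Ioc, ENNReal.ofReal_mul (by positivity)]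
      _ ≤ ∫⁻ t in Set.Ioc u v, ENNReal.ofReal (ρ t) := by
          refine setLIntegral_mono' measurableSet_Ioc fun t ht => ENNReal.ofReal_le_ofReal ?_
          refine (hball ?_).le
          rw [Real.dist_eq, abs_lt]
          constructor <;> linarith [ht.1, ht.2]
  refine ⟨ρ p / 2, η / 2, by positivity, by positivity, fun t => ?_⟩
  have hm := monotone_mcdf μ
  rcases le_total p t with h | h
  · rw [abs_of_nonneg (sub_nonneg.2 (hm h)), abs_of_nonneg (sub_nonneg.2 h)]
    have h0 : 0 ≤ min (t - p) (η / 2) := le_min (by linarith) (by linarith)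
    have h1 := hIoc p (p + min (t - p) (η / 2)) (by linarith) (by linarith)
      (by linarith [min_le_right (t - p) (η / 2)])
    have h2 : mcdf μ (p + min (t - p) (η / 2)) ≤ mcdf μ t :=
      hm (by linarith [min_le_left (t - p) (η / 2)])
    rw [add_sub_cancel_left] at h1
    linarith
  · rw [abs_of_nonpos (sub_nonpos.2 (hm h)), abs_of_nonpos (sub_nonpos.2 h)]
    have h0 : 0 ≤ min (-(t - p)) (η / 2) := le_min (by linarith) (by linarith)
    have h1 := hIoc (p - min (-(t - p)) (η / 2)) p (by linarith)
      (by linarith [min_le_right (-(t - p)) (η / 2)]) (by linarith)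
    have h2 : mcdf μ t ≤ mcdf μ (p - min (-(t - p)) (η / 2)) :=
      hm (by linarith [min_le_left (-(t - p)) (η / 2)])
    rw [sub_sub_self] at h1
    linarith

section Percentile

variable {n k : ℕ}

theorem card_filter_sort_le (x : Fin n → ℝ) (t : ℝ) :
    (Finset.univ.filter fun i => x (Tuple.sort x i) ≤ t).card =
      (Finset.univ.filter fun i => x i ≤ t).card :=
  Finset.card_equiv (Tuple.sort x) (by simp)

theorem mcdf_empMeas_of_lt_percentileMech (hn : 0 < n) {v : Fin k → ℝ} {j : Fin k}
    (h0 : 0 ≤ v j) {x : Fin n → ℝ} {t : ℝ} (ht : t < percentileMech v x j) :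
    mcdf (empMeas x) t ≤ v j := by
  have hn' : (1 : ℝ) ≤ n := by exact_mod_cast hn
  rw [percentileMech, dif_pos hn] at ht
  have hcard := (Tuple.lt_card_le_iff_apply_le_of_monotone (a := t) (Tuple.monotone_sort x)).not.2
    (not_le.2 ht)
  simp only [Function.comp_apply, card_filter_sort_le, not_lt] at hcard
  have hfl : ((Finset.univ.filter fun i => x i ≤ t).card : ℝ) ≤ ((n : ℝ) - 1) * v j :=
    (Nat.cast_le.2 (hcard.trans (min_le_left _ _))).trans
      (Nat.floor_le (mul_nonneg (by linarith) h0))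
  rw [mcdf_empMeas_eq_card, inv_mul_le_iff₀ (by linarith)]
  linarith

theorem le_mcdf_empMeas_of_percentileMech_le (hn : 0 < n) {v : Fin k → ℝ} {j : Fin k}
    (h1 : v j ≤ 1) {x : Fin n → ℝ} {t : ℝ} (ht : percentileMech v x j ≤ t) :
    v j - 1 / n ≤ mcdf (empMeas x) t := by
  have hn' : (1 : ℝ) ≤ n := by exact_mod_cast hn
  rw [percentileMech, dif_pos hn] at ht
  have hcard := (Tuple.lt_card_le_iff_apply_le_of_monotone (a := t) (Tuple.monotone_sort x)).2 ht
  simp only [Function.comp_apply, card_filter_sort_le] at hcard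
  have hle : ⌊((n : ℝ) - 1) * v j⌋₊ ≤ n - 1 := by
    refine Nat.floor_le_of_le ?_
    rw [Nat.cast_sub hn, Nat.cast_one]
    exact mul_le_of_le_one_right (by linarith) h1
  rw [min_eq_left hle] at hcard
  have h2 := (Nat.floor_lt' (by omega)).1 hcard
  rw [mcdf_empMeas_eq_card, ← div_eq_inv_mul, le_div_iff₀ (by linarith), sub_mul,
    one_div_mul_cancel (by linarith)]
  linarith

theorem half_mul_min_le_abs_mcdf_sub {μ : Measure ℝ} [IsProbabilityMeasure μ] {p c η ε : ℝ}
    (hc : 0 < c) (hgrowth : ∀ t, c * min |t - p| η ≤ |mcdf μ t - mcdf μ p|)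
    (hn : 0 < n) (hεη : ε ≤ η) (hε : 1 / n ≤ c * ε / 2) {v : Fin k → ℝ} {j : Fin k}
    (hv : v j = mcdf μ p) {x : Fin n → ℝ} {t : ℝ}
    (ht : t ∈ Set.Ioo (min p (percentileMech v x j)) (max p (percentileMech v x j)))
    (htε : ε ≤ |t - p|) :
    c / 2 * min |t - p| η ≤ |mcdf (empMeas x) t - mcdf μ t| := by
  have hmin : ε ≤ min |t - p| η := le_min htε hεη
  have hmul : c * ε ≤ c * min |t - p| η := by gcongr
  have hn1 : (0 : ℝ) < 1 / n := by positivity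
  have hg := hgrowth t
  have hm := monotone_mcdf μ
  have hcases : (p < t ∧ t < percentileMech v x j) ∨ (percentileMech v x j < t ∧ t < p) := by
    rcases le_total p (percentileMech v x j) with h | h
    · rw [min_eq_left h, max_eq_right h] at ht; exact Or.inl ht
    · rw [min_eq_right h, max_eq_left h] at ht; exact Or.inr ht
  rcases hcases with ⟨h1, h2⟩ | ⟨h1, h2⟩
  · have h3 := mcdf_empMeas_of_lt_percentileMech hn (hv ▸ mcdf_nonneg μ p) h2
    rw [abs_of_nonneg (sub_nonneg.2 (hm h1.le))] at hg
    rw [abs_sub_comm (mcdf (empMeas x) t)]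
    refine le_trans ?_ (le_abs_self _)
    linarith
  · have h3 := le_mcdf_empMeas_of_percentileMech_le hn (hv ▸ mcdf_le_one μ p) h1.le
    rw [abs_of_nonpos (sub_nonpos.2 (hm h2.le))] at hg
    refine le_trans ?_ (le_abs_self _)
    linarith

theorem integral_cauchy_kernel (p : ℝ) {ε : ℝ} (hε : 0 < ε) :
    ∫⁻ t, ENNReal.ofReal (1 + ((t - p) / ε) ^ 2)⁻¹ = ENNReal.ofReal (ε * Real.pi) := by
  have h_int : Integrable fun t : ℝ => (1 + ((t - p) / ε) ^ 2)⁻¹ :=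
    (integrable_inv_one_add_sq.comp_div hε.ne').comp_sub_right p
  rw [← ofReal_integral_eq_lintegral_ofReal h_int (ae_of_all _ fun t => by positivity),
    integral_sub_right_eq_self (fun t : ℝ => (1 + (t / ε) ^ 2)⁻¹) p,
    Measure.integral_comp_div (fun t : ℝ => (1 + t ^ 2)⁻¹), integral_univ_inv_one_add_sq,
    abs_of_pos hε, smul_eq_mul]

/-- Integrand dominating the indicator of the interval between the percentile `p` and the
corresponding order statistic of the sample `x`. -/
noncomputable def devKernel (μ : Measure ℝ) (p c η ε : ℝ) (x : Fin n → ℝ) (t : ℝ) : ℝ≥0∞ :=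
  (Set.Ioo (p - ε) (p + ε)).indicator 1 t +
    ENNReal.ofReal (8 / (c ^ 2 * ε ^ 2)) * (ENNReal.ofReal (1 + ((t - p) / ε) ^ 2)⁻¹ *
      ENNReal.ofReal ((mcdf (empMeas x) t - mcdf μ t) ^ 2)) +
    ENNReal.ofReal (2 / (c * η)) * ENNReal.ofReal |mcdf (empMeas x) t - mcdf μ t|

theorem measurable_devKernel (μ : Measure ℝ) [IsProbabilityMeasure μ] (p c η ε : ℝ) :
    Measurable (Function.uncurry (devKernel (n := n) μ p c η ε)) := by
  have h1 := measurable_mcdf_empMeas (n := n)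
  have h2 : Measurable fun q : (Fin n → ℝ) × ℝ => mcdf μ q.2 :=
    (measurable_mcdf μ).comp measurable_snd
  have h3 : Measurable fun q : (Fin n → ℝ) × ℝ =>
      (Set.Ioo (p - ε) (p + ε)).indicator (1 : ℝ → ℝ≥0∞) q.2 :=
    (measurable_one.indicator measurableSet_Ioo).comp measurable_snd
  have h4 : Measurable fun q : (Fin n → ℝ) × ℝ => ENNReal.ofReal (1 + ((q.2 - p) / ε) ^ 2)⁻¹ := by
    fun_prop
  exact (h3.add (measurable_const.mul (h4.mul ((h1.sub h2).pow_const 2).ennreal_ofReal))).add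
    (measurable_const.mul (h1.sub h2).norm.ennreal_ofReal)

theorem ofReal_abs_percentileMech_sub_le {μ : Measure ℝ} [IsProbabilityMeasure μ] {p c η ε : ℝ}
    (hc : 0 < c) (hη : 0 < η) (hε0 : 0 < ε)
    (hgrowth : ∀ t, c * min |t - p| η ≤ |mcdf μ t - mcdf μ p|)
    (hn : 0 < n) (hεη : ε ≤ η) (hε : 1 / n ≤ c * ε / 2) {v : Fin k → ℝ} {j : Fin k}
    (hv : v j = mcdf μ p) (x : Fin n → ℝ) :
    ENNReal.ofReal |percentileMech v x j - p| ≤ ∫⁻ t, devKernel μ p c η ε x t := by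
  set X := percentileMech v x j
  have hvol : ENNReal.ofReal |X - p| = ∫⁻ t, (Set.Ioo (min p X) (max p X)).indicator 1 t := by
    rw [lintegral_indicator_one measurableSet_Ioo, Real.volume_Ioo, max_sub_min_eq_abs]
  rw [hvol]
  refine lintegral_mono fun t => ?_
  by_cases ht : t ∈ Set.Ioo (min p X) (max p X)
  swap
  · simp [ht]
  simp only [ht, Set.indicator_of_mem, Pi.one_apply, devKernel]
  by_cases htε : |t - p| < ε
  · have hmem : t ∈ Set.Ioo (p - ε) (p + ε) := by
      rw [abs_lt] at htε
      constructor <;> linarith [htε.1, htε.2]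
    rw [Set.indicator_of_mem hmem, Pi.one_apply, add_assoc]
    exact le_self_add
  push Not at htε
  have hD := half_mul_min_le_abs_mcdf_sub hc hgrowth hn hεη hε hv ht htε
  set D := mcdf (empMeas x) t - mcdf μ t
  rcases le_total |t - p| η with h | h
  · rw [min_eq_left h] at hD
    refine le_trans ?_ le_self_add
    refine le_trans ?_ le_add_self
    rw [← ENNReal.ofReal_mul (by positivity), ← ENNReal.ofReal_mul (by positivity),
      ENNReal.one_le_ofReal]
    have h1 : c ^ 2 / 4 * (t - p) ^ 2 ≤ D ^ 2 := by
      rw [← sq_abs D, ← sq_abs (t - p)]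
      calc c ^ 2 / 4 * |t - p| ^ 2 = (c / 2 * |t - p|) ^ 2 := by ring
        _ ≤ |D| ^ 2 := by gcongr
    have h2 : ε ^ 2 ≤ (t - p) ^ 2 := by
      rw [← sq_abs (t - p)]
      gcongr
    have h3 : 8 / (c ^ 2 * ε ^ 2) * ((1 + ((t - p) / ε) ^ 2)⁻¹ * D ^ 2) =
        8 * D ^ 2 / (c ^ 2 * (ε ^ 2 + (t - p) ^ 2)) := by
      field_simp
    rw [h3, le_div_iff₀ (by positivity)]
    nlinarith [sq_nonneg c, mul_le_mul_of_nonneg_left h2 (sq_nonneg c)]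
  · rw [min_eq_right h] at hD
    refine le_trans ?_ le_add_self
    rw [← ENNReal.ofReal_mul (by positivity), ENNReal.one_le_ofReal]
    calc (1 : ℝ) = 2 / (c * η) * (c / 2 * η) := by field_simp
      _ ≤ _ := by gcongr

theorem lintegral_lintegral_abs_mcdf_empMeas_sub_le (μ : Measure ℝ) [IsProbabilityMeasure μ]
    [NeZero n] (hL : ∫⁻ t, ENNReal.ofReal √(mcdf μ t * (1 - mcdf μ t)) < ⊤) :
    ∫⁻ t, ∫⁻ x : Fin n → ℝ, ENNReal.ofReal |mcdf (empMeas x) t - mcdf μ t|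
        ∂(Measure.pi fun _ => μ) ≤
      ENNReal.ofReal ((∫⁻ t, ENNReal.ofReal √(mcdf μ t * (1 - mcdf μ t))).toReal / √n) := by
  have hn : (0 : ℝ) < n := by exact_mod_cast Nat.pos_of_ne_zero (NeZero.ne n)
  refine (lintegral_mono fun t => lintegral_abs_mcdf_empMeas_sub_le μ t).trans ?_
  simp only [div_eq_mul_inv]
  rw [ENNReal.ofReal_mul ENNReal.toReal_nonneg, ENNReal.ofReal_toReal hL.ne]
  simp only [ENNReal.ofReal_mul (Real.sqrt_nonneg _)]
  rw [lintegral_mul_const' _ _ ENNReal.ofReal_ne_top]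

theorem lintegral_devKernel_le (μ : Measure ℝ) [IsProbabilityMeasure μ] [NeZero n]
    (hL : ∫⁻ t, ENNReal.ofReal √(mcdf μ t * (1 - mcdf μ t)) < ⊤) (p : ℝ) {c η ε : ℝ}
    (hc : 0 < c) (hη : 0 < η) (hε : 0 < ε) :
    ∫⁻ x : Fin n → ℝ, (∫⁻ t, devKernel μ p c η ε x t) ∂(Measure.pi fun _ => μ) ≤
      ENNReal.ofReal (2 * ε + 8 / (c ^ 2 * ε ^ 2) * (ε * Real.pi * (1 / n)) + 2 / (c * η) *
        ((∫⁻ t, ENNReal.ofReal √(mcdf μ t * (1 - mcdf μ t))).toReal / √n)) := by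
  have hD : Measurable fun q : (Fin n → ℝ) × ℝ => mcdf (empMeas q.1) q.2 - mcdf μ q.2 :=
    measurable_mcdf_empMeas.sub ((measurable_mcdf μ).comp measurable_snd)
  have hDx : ∀ t, Measurable fun x : Fin n → ℝ => mcdf (empMeas x) t - mcdf μ t := fun t =>
    (measurable_mcdf_empMeas_left t).sub_const _
  rw [lintegral_lintegral_swap (measurable_devKernel μ p c η ε).aemeasurable]
  have hpt : ∀ t, ∫⁻ x : Fin n → ℝ, devKernel μ p c η ε x t ∂(Measure.pi fun _ => μ) ≤
      (Set.Ioo (p - ε) (p + ε)).indicator 1 t +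
      ENNReal.ofReal (8 / (c ^ 2 * ε ^ 2)) * (ENNReal.ofReal (1 + ((t - p) / ε) ^ 2)⁻¹ *
        ENNReal.ofReal (1 / n)) +
      ENNReal.ofReal (2 / (c * η)) * ∫⁻ x : Fin n → ℝ,
        ENNReal.ofReal |mcdf (empMeas x) t - mcdf μ t| ∂(Measure.pi fun _ => μ) := fun t => by
    simp only [devKernel]
    have hm : Measurable fun x : Fin n → ℝ => ENNReal.ofReal (2 / (c * η)) *
        ENNReal.ofReal |mcdf (empMeas x) t - mcdf μ t| :=
      measurable_const.mul (hDx t).norm.ennreal_ofReal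
    rw [lintegral_add_right _ hm,
      lintegral_add_left measurable_const, lintegral_const_mul' _ _ ENNReal.ofReal_ne_top,
      lintegral_const_mul' _ _ ENNReal.ofReal_ne_top,
      lintegral_const_mul' _ _ ENNReal.ofReal_ne_top, lintegral_const, measure_univ, mul_one,
      lintegral_mcdf_empMeas_sub_sq]
    have h1 := mcdf_nonneg μ t
    have h2 := mcdf_le_one μ t
    have h3 : mcdf μ t * (1 - mcdf μ t) ≤ 1 := by nlinarith
    gcongr
  refine (lintegral_mono hpt).trans ?_
  have hk : Measurable fun t : ℝ => ENNReal.ofReal (1 + ((t - p) / ε) ^ 2)⁻¹ := by fun_prop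
  have hind : Measurable ((Set.Ioo (p - ε) (p + ε)).indicator (1 : ℝ → ℝ≥0∞)) :=
    measurable_one.indicator measurableSet_Ioo
  have hsum : Measurable fun t : ℝ => (Set.Ioo (p - ε) (p + ε)).indicator (1 : ℝ → ℝ≥0∞) t +
      ENNReal.ofReal (8 / (c ^ 2 * ε ^ 2)) * (ENNReal.ofReal (1 + ((t - p) / ε) ^ 2)⁻¹ *
        ENNReal.ofReal (1 / n)) :=
    hind.add (measurable_const.mul (hk.mul_const _))
  rw [lintegral_add_left hsum,
    lintegral_add_left hind, lintegral_indicator_one measurableSet_Ioo, Real.volume_Ioo,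
    lintegral_const_mul' _ _ ENNReal.ofReal_ne_top, lintegral_mul_const' _ _ ENNReal.ofReal_ne_top,
    lintegral_const_mul' _ _ ENNReal.ofReal_ne_top, integral_cauchy_kernel p hε,
    ENNReal.ofReal_add (by positivity) (by positivity),
    ENNReal.ofReal_add (by positivity) (by positivity), ENNReal.ofReal_mul (p := 8 / _)
    (by positivity), ENNReal.ofReal_mul (p := 2 / (c * η)) (by positivity),
    ENNReal.ofReal_mul (p := ε * Real.pi) (by positivity)]
  have h1 : p + ε - (p - ε) = 2 * ε := by ring
  rw [h1]
  gcongr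
  exact lintegral_lintegral_abs_mcdf_empMeas_sub_le μ hL

theorem exists_percentileMech_deviation_bound {μ : Measure ℝ} [IsProbabilityMeasure μ]
    (hL : ∫⁻ t, ENNReal.ofReal √(mcdf μ t * (1 - mcdf μ t)) < ⊤) {p c η : ℝ}
    (hc : 0 < c) (hη : 0 < η) (hgrowth : ∀ t, c * min |t - p| η ≤ |mcdf μ t - mcdf μ p|)
    {v : Fin k → ℝ} {j : Fin k} (hv : v j = mcdf μ p) :
    ∃ B : ℝ, 0 ≤ B ∧ ∀ᶠ n : ℕ in atTop, ∃ A : (Fin n → ℝ) → ℝ≥0∞, Measurable A ∧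
      (∀ x, ENNReal.ofReal |percentileMech v x j - p| ≤ A x) ∧
      ∫⁻ x, A x ∂(Measure.pi fun _ => μ) ≤ ENNReal.ofReal (B / √n) := by
  set L := (∫⁻ t, ENNReal.ofReal √(mcdf μ t * (1 - mcdf μ t))).toReal with hLdef
  have hL0 : 0 ≤ L := ENNReal.toReal_nonneg
  refine ⟨4 / c + 4 * Real.pi / c + 2 / (c * η) * L, by positivity, ?_⟩
  have htend : Tendsto (fun n : ℕ => 2 / c / √(n : ℝ)) atTop (𝓝 0) :=
    (Real.tendsto_sqrt_atTop.comp tendsto_natCast_atTop_atTop).const_div_atTop _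
  filter_upwards [htend.eventually (gt_mem_nhds hη), eventually_gt_atTop 0] with n hnη hn
  have : NeZero n := ⟨hn.ne'⟩
  have hn1 : (1 : ℝ) ≤ n := by exact_mod_cast hn
  have hs : 0 < √(n : ℝ) := Real.sqrt_pos.2 (by linarith)
  have hsq : √(n : ℝ) * √n = n := Real.mul_self_sqrt (by linarith)
  have hs1 : 1 ≤ √(n : ℝ) := Real.one_le_sqrt.2 hn1
  have hε0 : 0 < 2 / c / √(n : ℝ) := by positivity
  refine ⟨fun x => ∫⁻ t, devKernel μ p c η (2 / c / √n) x t,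
    (measurable_devKernel μ p c η _).lintegral_prod_right',
    ofReal_abs_percentileMech_sub_le hc hη hε0 hgrowth hn hnη.le ?_ hv,
    (lintegral_devKernel_le μ hL p hc hη hε0).trans_eq ?_⟩
  · have h : c * (2 / c / √(n : ℝ)) / 2 = 1 / √n := by field_simp
    rw [h]
    exact one_div_le_one_div_of_le hs (by nlinarith)
  · rw [← hLdef]
    congr 1
    have h : 1 / (n : ℝ) = 1 / √n * (1 / √n) := by rw [one_div_mul_one_div, hsq]
    rw [h]
    field_simp
    ring

end Percentile

section Ratio

variable {n k : ℕ} [NeZero k] {μ : Measure ℝ} [IsProbabilityMeasure μ]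

theorem integrable_SC (hμ : Integrable (fun t : ℝ => t) μ) (z : Fin k → ℝ) :
    Integrable (fun x : Fin n → ℝ => SC x z) (Measure.pi fun _ => μ) := by
  simp only [SC_eq]
  exact (integrable_finsetSum _ fun i _ =>
    integrable_comp_eval (μ := fun _ : Fin n => μ) (integrable_minDist hμ z)).const_mul _

theorem integral_SC [NeZero n] (hμ : Integrable (fun t : ℝ => t) μ) (z : Fin k → ℝ) :
    ∫ x : Fin n → ℝ, SC x z ∂(Measure.pi fun _ => μ) = ∫ t, minDist z t ∂μ := by
  have hn : (n : ℝ) ≠ 0 := by exact_mod_cast NeZero.ne n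
  have hi := integrable_minDist hμ z
  simp only [SC_eq]
  rw [integral_const_mul, integral_finsetSum _ fun i _ =>
    integrable_comp_eval (μ := fun _ : Fin n => μ) hi]
  simp only [integral_comp_eval (μ := fun _ : Fin n => μ) hi.aestronglyMeasurable]
  simp [inv_mul_cancel_left₀ hn]

theorem integrable_SCopt (hμ : Integrable (fun t : ℝ => t) μ) :
    Integrable (fun x : Fin n → ℝ => SCopt k x) (Measure.pi fun _ => μ) :=
  (integrable_SC hμ fun _ => 0).mono' measurable_SCopt.aestronglyMeasurable <|
    ae_of_all _ fun x => by
    rw [Real.norm_of_nonneg (SCopt_nonneg x)]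
    exact SCopt_le x _

theorem ofReal_le_ofReal_SCopt_add [NeZero n] (hμ : Integrable (fun t : ℝ => t) μ) {w : ℝ}
    (hw : ∀ z : Fin k → ℝ, w ≤ ∫ t, minDist z t ∂μ) (x : Fin n → ℝ) :
    ENNReal.ofReal w ≤ ENNReal.ofReal (SCopt k x) +
      ∫⁻ t, ENNReal.ofReal |mcdf (empMeas x) t - mcdf μ t| := by
  set Δ := ∫⁻ t, ENNReal.ofReal |mcdf (empMeas x) t - mcdf μ t|
  rcases eq_or_ne Δ ⊤ with h | h
  · simp [h]
  have key : w - Δ.toReal ≤ SCopt k x := by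
    refine le_ciInf fun z => ?_
    have h1 := (ENNReal.ofReal_le_ofReal (hw z)).trans
      ((lipschitzWith_minDist z).ofReal_integral_le hμ (integrable_empMeas x fun t => t))
    change _ ≤ _ + Δ at h1
    rw [← SC_eq_integral, ← ENNReal.ofReal_toReal h,
      ← ENNReal.ofReal_add (SC_nonneg x z) ENNReal.toReal_nonneg,
      ENNReal.ofReal_le_ofReal_iff (add_nonneg (SC_nonneg x z) ENNReal.toReal_nonneg)] at h1
    linarith
  rw [← ENNReal.ofReal_toReal h, ← ENNReal.ofReal_add (SCopt_nonneg x) ENNReal.toReal_nonneg]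
  exact ENNReal.ofReal_le_ofReal (by linarith)

theorem le_integral_SCopt_add [NeZero n] (hμ : Integrable (fun t : ℝ => t) μ)
    (hL : ∫⁻ t, ENNReal.ofReal √(mcdf μ t * (1 - mcdf μ t)) < ⊤) {w : ℝ}
    (hw : ∀ z : Fin k → ℝ, w ≤ ∫ t, minDist z t ∂μ) :
    w ≤ ∫ x : Fin n → ℝ, SCopt k x ∂(Measure.pi fun _ => μ) +
      (∫⁻ t, ENNReal.ofReal √(mcdf μ t * (1 - mcdf μ t))).toReal / √n := by
  have hnn : 0 ≤ ∫ x : Fin n → ℝ, SCopt k x ∂(Measure.pi fun _ => μ) :=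
    integral_nonneg fun x => SCopt_nonneg x
  have hnn' : 0 ≤ (∫⁻ t, ENNReal.ofReal √(mcdf μ t * (1 - mcdf μ t))).toReal / √n := by positivity
  rw [← ENNReal.ofReal_le_ofReal_iff (add_nonneg hnn hnn'), ENNReal.ofReal_add hnn hnn',
    ofReal_integral_eq_lintegral_ofReal (integrable_SCopt hμ) (ae_of_all _ fun x => SCopt_nonneg x)]
  have hD : Measurable fun q : (Fin n → ℝ) × ℝ =>
      ENNReal.ofReal |mcdf (empMeas q.1) q.2 - mcdf μ q.2| :=
    (measurable_mcdf_empMeas.sub ((measurable_mcdf μ).comp measurable_snd)).norm.ennreal_ofReal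
  calc ENNReal.ofReal w = ∫⁻ _ : Fin n → ℝ, ENNReal.ofReal w ∂(Measure.pi fun _ => μ) := by simp
    _ ≤ ∫⁻ x : Fin n → ℝ, (ENNReal.ofReal (SCopt k x) +
        ∫⁻ t, ENNReal.ofReal |mcdf (empMeas x) t - mcdf μ t|) ∂(Measure.pi fun _ => μ) :=
      lintegral_mono fun x => ofReal_le_ofReal_SCopt_add hμ hw x
    _ ≤ _ := by
      rw [lintegral_add_left measurable_SCopt.ennreal_ofReal,
        lintegral_lintegral_swap hD.aemeasurable]
      gcongr
      exact lintegral_lintegral_abs_mcdf_empMeas_sub_le μ hL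

theorem integral_SCv_le [NeZero n] (hμ : Integrable (fun t : ℝ => t) μ) {v y : Fin k → ℝ}
    {A : Fin k → (Fin n → ℝ) → ℝ≥0∞} (hA : ∀ j, Measurable (A j))
    (hvA : ∀ j x, ENNReal.ofReal |percentileMech v x j - y j| ≤ A j x) {b : Fin k → ℝ}
    (hb0 : ∀ j, 0 ≤ b j)
    (hb : ∀ j, ∫⁻ x, A j x ∂(Measure.pi fun _ => μ) ≤ ENNReal.ofReal (b j)) :
    ∫ x : Fin n → ℝ, SCv v x ∂(Measure.pi fun _ => μ) ≤ ∫ t, minDist y t ∂μ + ∑ j, b j := by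
  have hW0 : 0 ≤ ∫ t, minDist y t ∂μ := integral_nonneg fun t => minDist_nonneg y t
  have hB0 : 0 ≤ ∑ j, b j := Finset.sum_nonneg fun j _ => hb0 j
  by_cases hm : AEStronglyMeasurable (fun x : Fin n → ℝ => SCv v x) (Measure.pi fun _ => μ)
  swap
  · rw [integral_undef fun h => hm h.aestronglyMeasurable]
    positivity
  rw [integral_eq_lintegral_of_nonneg_ae (f := fun x => SCv v x)
    (ae_of_all _ fun x => SC_nonneg x _) hm]
  refine ENNReal.toReal_le_of_le_ofReal (by positivity) ?_
  calc ∫⁻ x : Fin n → ℝ, ENNReal.ofReal (SCv v x) ∂(Measure.pi fun _ => μ)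
      ≤ ∫⁻ x : Fin n → ℝ, (ENNReal.ofReal (SC x y) + ∑ j, A j x) ∂(Measure.pi fun _ => μ) := by
        refine lintegral_mono fun x => ?_
        have h := SC_le_add_sum (Nat.pos_of_ne_zero (NeZero.ne n)) x y (percentileMech v x)
        refine (ENNReal.ofReal_le_ofReal h).trans ?_
        rw [ENNReal.ofReal_add (SC_nonneg x y) (Finset.sum_nonneg fun j _ => abs_nonneg _),
          ENNReal.ofReal_sum_of_nonneg fun j _ => abs_nonneg _]
        gcongr with j
        exact hvA j x
    _ = ENNReal.ofReal (∫ t, minDist y t ∂μ) +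
        ∑ j, ∫⁻ x, A j x ∂(Measure.pi fun _ => μ) := by
        rw [lintegral_add_left (continuous_SC y).measurable.ennreal_ofReal,
          lintegral_finsetSum _ fun j _ => hA j,
          ← ofReal_integral_eq_lintegral_ofReal (integrable_SC hμ y)
            (ae_of_all _ fun x => SC_nonneg x y), integral_SC hμ y]
    _ ≤ _ := by
        rw [ENNReal.ofReal_add hW0 hB0, ENNReal.ofReal_sum_of_nonneg fun j _ => hb0 j]
        gcongr with j
        exact hb j

end Ratio

theorem div_le_one_add_div_of_le_add {N D W a b s : ℝ} (hW : 0 < W) (hs : 0 < s) (ha : 0 ≤ a)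
    (hb : 0 ≤ b) (hsb : b / s ≤ W / 2) (hN : N ≤ W + a / s) (hD : W ≤ D + b / s) :
    N / D ≤ 1 + 2 * (a + b) / W / s := by
  have hD2 : W / 2 ≤ D := by linarith
  have hD0 : 0 < D := by linarith
  have h : (a + b) / s ≤ 2 * (a + b) / W / s * D := by
    calc (a + b) / s = 2 * (a + b) / W / s * (W / 2) := by field_simp
      _ ≤ _ := by gcongr
  rw [div_le_iff₀ hD0, add_mul, one_mul]
  rw [add_div] at h
  linarith

theorem exists_pos_forall_le_one_add_div_sqrt {f : ℕ → ℝ} {C : ℝ} (hC : 0 ≤ C)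
    (hf : ∀ᶠ n : ℕ in atTop, f n ≤ 1 + C / √n) :
    ∃ C' : ℝ, 0 < C' ∧ ∀ n : ℕ, 0 < n → f n ≤ 1 + C' / √n := by
  obtain ⟨N, hN⟩ := eventually_atTop.1 hf
  have hS : 0 ≤ ∑ m ∈ Finset.range N, |f m| * √m := Finset.sum_nonneg fun m _ => by positivity
  refine ⟨C + ∑ m ∈ Finset.range N, |f m| * √m + 1, by positivity, fun n hn => ?_⟩
  have hs : 0 < √(n : ℝ) := Real.sqrt_pos.2 (by exact_mod_cast hn)
  rcases le_or_gt N n with h | h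
  · refine (hN n h).trans ?_
    gcongr
    linarith
  · have h1 : |f n| * √n ≤ ∑ m ∈ Finset.range N, |f m| * √m :=
      Finset.single_le_sum (f := fun m : ℕ => |f m| * √m) (fun m _ => by positivity)
        (Finset.mem_range.2 h)
    have h2 : f n ≤ (C + ∑ m ∈ Finset.range N, |f m| * √m + 1) / √n := by
      rw [le_div_iff₀ hs]
      have := mul_le_mul_of_nonneg_right (le_abs_self (f n)) hs.le
      linarith
    linarith

/-- The Bayesian approximation ratio of the optimal percentile mechanism is at
most `1 + C/√n` for all `n > k`. -/
theorem stmt11 (μ : Measure ℝ) (hμ : BasicAssumptions μ)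
    (hmom : (∃ a b : ℝ, μ ((Set.Icc a b)ᶜ) = 0) ∨
      ∃ δ : ℝ, 0 < δ ∧ Integrable (fun x : ℝ => |x| ^ ((2 : ℝ) + δ)) μ)
    {k : ℕ} (hk : 1 ≤ k)
    (νstar : Measure ℝ) (hνPk : νstar ∈ Pk k) (hopt : W1 μ νstar = projDist k μ)
    (y : Fin k → ℝ) (hy : StrictMono y) (hsupp : msupport νstar = Set.range y) :
    ∃ C : ℝ, 0 < C ∧ ∀ n : ℕ, k < n →
      (∫ x : Fin n → ℝ, SCv (fun j => mcdf μ (y j)) x ∂(Measure.pi fun _ : Fin n => μ)) /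
          (∫ x : Fin n → ℝ, SCopt k x ∂(Measure.pi fun _ : Fin n => μ)) ≤
        1 + C / Real.sqrt n := by
  have : IsProbabilityMeasure μ := hμ.1
  have : IsProbabilityMeasure νstar := hνPk.1
  have : NeZero k := ⟨by omega⟩
  have : NullSingletonClass μ := ⟨fun t => hμ.absolutelyContinuous (measure_singleton t)⟩
  obtain ⟨r, hr, hmr⟩ := exists_moment hmom
  have h_int := integrable_id_of_moment hr hmr
  have hL := lintegral_sqrt_mcdf_lt_top hr hmr
  have hmin : ∀ z : Fin k → ℝ, ∫ t, minDist y t ∂μ ≤ ∫ t, minDist z t ∂μ := fun z =>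
    ((integral_minDist_le_W1 h_int (measure_compl_range_eq_zero hνPk hsupp)).trans_eq hopt).trans
      (projDist_le μ z)
  have hW := integral_minDist_pos h_int y
  have hdev : ∀ j, ∃ B : ℝ, 0 ≤ B ∧ ∀ᶠ n : ℕ in atTop, ∃ A : (Fin n → ℝ) → ℝ≥0∞, Measurable A ∧
      (∀ x, ENNReal.ofReal |percentileMech (fun j => mcdf μ (y j)) x j - y j| ≤ A x) ∧
      ∫⁻ x, A x ∂(Measure.pi fun _ => μ) ≤ ENNReal.ofReal (B / √n) := fun j => by
    obtain ⟨c, η, hc, hη, hg⟩ := hμ.exists_mcdf_growth (measure_Iio_ne_zero h_int hmin j)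
      (measure_Ioi_ne_zero h_int hmin j)
    exact exists_percentileMech_deviation_bound hL hc hη hg rfl
  choose B hB0 hB using hdev
  set L := (∫⁻ t, ENNReal.ofReal √(mcdf μ t * (1 - mcdf μ t))).toReal with hLdef
  have hL0 : 0 ≤ L := ENNReal.toReal_nonneg
  have hBs : 0 ≤ ∑ j, B j := Finset.sum_nonneg fun j _ => hB0 j
  have htend : Tendsto (fun n : ℕ => L / √(n : ℝ)) atTop (𝓝 0) :=
    (Real.tendsto_sqrt_atTop.comp tendsto_natCast_atTop_atTop).const_div_atTop _
  obtain ⟨C, hC, hCn⟩ := exists_pos_forall_le_one_add_div_sqrt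
    (f := fun n : ℕ =>
      (∫ x : Fin n → ℝ, SCv (fun j => mcdf μ (y j)) x ∂(Measure.pi fun _ : Fin n => μ)) /
        (∫ x : Fin n → ℝ, SCopt k x ∂(Measure.pi fun _ : Fin n => μ)))
    (C := 2 * (∑ j, B j + L) / ∫ t, minDist y t ∂μ) (by positivity) (by
      filter_upwards [eventually_all.2 hB, htend.eventually (ge_mem_nhds (half_pos hW)),
        eventually_gt_atTop 0] with n hA hLn hn
      have : NeZero n := ⟨hn.ne'⟩
      choose A hAm hvA hAB using hA
      have hup := integral_SCv_le h_int hAm hvA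
        (fun j => div_nonneg (hB0 j) (Real.sqrt_nonneg _)) hAB
      rw [← Finset.sum_div] at hup
      exact div_le_one_add_div_of_le_add hW (Real.sqrt_pos.2 (by exact_mod_cast hn)) hBs hL0 hLn
        hup (le_integral_SCopt_add h_int hL hmin))
  exact ⟨C, hC, fun n hn => hCn n (by omega)⟩
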